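/- For every β ∈ ℤ^d one has G^β_β ≤ 0, and for all α, β ∈ ℤ^d with α ≠ β one has G^α_β ≥ 0. -/

import Mathlib

open MeasureTheory Set

noncomputable section

abbrev Ed (d : ℕ) := EuclideanSpace ℝ (Fin d)

def cell (d : ℕ) (dx : ℝ) (α : Fin d → ℤ) : Set (Ed d) :=
  {x | ∀ i, dx * (α i : ℝ) < x i ∧ x i < dx * (α i : ℝ) + dx}

def ind (d : ℕ) (S : Set (Ed d)) : Ed d → ℝ :=
  S.indicator fun _ => 1

def gam (d : ℕ) (dx : ℝ) (μ : Measure (Ed d)) (l : Fin d) : ℝ :=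
  - ∫ z in {z : Ed d | dx / 2 < ‖z‖ ∧ ‖z‖ ≤ 1}, z l ∂μ

def Dup (d : ℕ) (dx : ℝ) (μ : Measure (Ed d)) (l : Fin d) (φ : Ed d → ℝ) (x : Ed d) : ℝ :=
  if 0 < gam d dx μ l then (φ (x + EuclideanSpace.single l dx) - φ x) / dx
  else (φ x - φ (x - EuclideanSpace.single l dx)) / dx

def Glow (d : ℕ) (dx : ℝ) (μ : Measure (Ed d)) (α β : Fin d → ℤ) : ℝ :=
  (dx ^ d)⁻¹ *
    ∫ x in cell d dx α, ∫ z in {z : Ed d | dx / 2 < ‖z‖},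
      (ind d (cell d dx β) (x + z) - ind d (cell d dx β) x) ∂μ

def Gup (d : ℕ) (dx : ℝ) (μ : Measure (Ed d)) (α β : Fin d → ℤ) : ℝ :=
  (dx ^ d)⁻¹ *
    ∑ l : Fin d, gam d dx μ l * ∫ x in cell d dx α, Dup d dx μ l (ind d (cell d dx β)) x

def Gw (d : ℕ) (dx : ℝ) (μ : Measure (Ed d)) (α β : Fin d → ℤ) : ℝ :=
  Glow d dx μ α β + Gup d dx μ α β

def GsplitLow (d : ℕ) (dx r : ℝ) (μ : Measure (Ed d)) (α β : Fin d → ℤ) : ℝ :=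
  (dx ^ d)⁻¹ *
    ∫ x in cell d dx α, ∫ z in {z : Ed d | dx / 2 < ‖z‖ ∧ ‖z‖ ≤ r},
      (ind d (cell d dx β) (x + z) - ind d (cell d dx β) x) ∂μ

def GsplitHigh (d : ℕ) (dx r : ℝ) (μ : Measure (Ed d)) (α β : Fin d → ℤ) : ℝ :=
  (dx ^ d)⁻¹ *
      ∫ x in cell d dx α, ∫ z in {z : Ed d | r < ‖z‖},
        (ind d (cell d dx β) (x + z) - ind d (cell d dx β) x) ∂μ
    + Gup d dx μ α β

def Aok (A : ℝ → ℝ) (LA : ℝ) : Prop :=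
  Monotone A ∧ (∀ a b : ℝ, |A a - A b| ≤ LA * |a - b|) ∧ A 0 = 0

def SolvesImplicitStep (d : ℕ) (dx : ℝ) (μ : Measure (Ed d)) (A : ℝ → ℝ) (dt : ℝ)
    (u h : (Fin d → ℤ) → ℝ) : Prop :=
  ∀ α, Summable (fun β => Gw d dx μ α β * A (u β)) ∧
    u α - dt * ∑' β, Gw d dx μ α β * A (u β) = h α

def Fractional (d : ℕ) (μ : Measure (Ed d)) (lam clam : ℝ) : Prop :=
  ∀ B : Set (Ed d), MeasurableSet B → B ⊆ {z : Ed d | 0 < ‖z‖ ∧ ‖z‖ < 1} →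
    μ B ≤ ∫⁻ z in B, ENNReal.ofReal (clam * ‖z‖ ^ (-(d : ℝ) - lam))

def Lhat (d : ℕ) (dx : ℝ) (μ : Measure (Ed d)) (w : Ed d → ℝ) (x : Ed d) : ℝ :=
  (∫ z in {z : Ed d | dx / 2 < ‖z‖}, (w (x + z) - w x) ∂μ) +
    ∑ l : Fin d, gam d dx μ l * Dup d dx μ l w x

def Ubar (d : ℕ) (dx : ℝ) (U : (Fin d → ℤ) → ℝ) (x : Ed d) : ℝ :=
  ∑' α : Fin d → ℤ, U α * ind d (cell d dx α) x

def cellAvg (d : ℕ) (dx : ℝ) (w : Ed d → ℝ) (x : Ed d) : ℝ :=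
  ∑' α : Fin d → ℤ, Set.indicator (cell d dx α)
    (fun _ => (dx ^ d)⁻¹ * ∫ y in cell d dx α, w y) x


lemma measurableSet_cell (d : ℕ) (dx : ℝ) (α : Fin d → ℤ) : MeasurableSet (cell d dx α) := by
  have h : cell d dx α =
      ⋂ i, {x : Ed d | dx * (α i : ℝ) < x i} ∩ {x : Ed d | x i < dx * (α i : ℝ) + dx} := by
    ext x
    simp [cell]
  rw [h]
  exact MeasurableSet.iInter fun i =>
    (measurableSet_lt measurable_const (by fun_prop)).inter
      (measurableSet_lt (by fun_prop) measurable_const)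

lemma cell_index_unique {d : ℕ} {dx : ℝ} (hdx : 0 < dx) {α β : Fin d → ℤ} {x : Ed d}
    (hα : x ∈ cell d dx α) (hβ : x ∈ cell d dx β) : α = β := by
  have key : ∀ {γ δ : Fin d → ℤ}, x ∈ cell d dx γ → x ∈ cell d dx δ → ∀ i, γ i ≤ δ i := by
    intro γ δ hγ hδ i
    have h : dx * (γ i : ℝ) < dx * ((δ i : ℝ) + 1) := by linarith [(hγ i).1, (hδ i).2]
    have h' : (γ i : ℝ) < (δ i : ℝ) + 1 := lt_of_mul_lt_mul_left h hdx.le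
    exact Int.lt_add_one_iff.mp (by exact_mod_cast h')
  exact funext fun i => le_antisymm (key hα hβ i) (key hβ hα i)

lemma ind_nonneg (d : ℕ) (S : Set (Ed d)) (x : Ed d) : 0 ≤ ind d S x :=
  indicator_nonneg (fun _ _ => zero_le_one) x

lemma ind_le_one (d : ℕ) (S : Set (Ed d)) (x : Ed d) : ind d S x ≤ 1 :=
  indicator_le_self' (fun _ _ => zero_le_one) x

/-- The upwind term is nonnegative at a minimum point. -/
lemma gam_mul_Dup_nonneg {d : ℕ} {dx : ℝ} (hdx : 0 < dx) (μ : Measure (Ed d)) (l : Fin d)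
    {φ : Ed d → ℝ} {x : Ed d} (hx : ∀ y, φ x ≤ φ y) :
    0 ≤ gam d dx μ l * Dup d dx μ l φ x := by
  unfold Dup
  split_ifs with h
  · exact mul_nonneg h.le (div_nonneg (sub_nonneg.2 (hx _)) hdx.le)
  · exact mul_nonneg_of_nonpos_of_nonpos (not_lt.1 h)
      (div_nonpos_of_nonpos_of_nonneg (sub_nonpos.2 (hx _)) hdx.le)

/-- The upwind term is nonpositive at a maximum point. -/
lemma gam_mul_Dup_nonpos {d : ℕ} {dx : ℝ} (hdx : 0 < dx) (μ : Measure (Ed d)) (l : Fin d)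
    {φ : Ed d → ℝ} {x : Ed d} (hx : ∀ y, φ y ≤ φ x) :
    gam d dx μ l * Dup d dx μ l φ x ≤ 0 := by
  unfold Dup
  split_ifs with h
  · exact mul_nonpos_of_nonneg_of_nonpos h.le
      (div_nonpos_of_nonpos_of_nonneg (sub_nonpos.2 (hx _)) hdx.le)
  · exact mul_nonpos_of_nonpos_of_nonneg (not_lt.1 h)
      (div_nonneg (sub_nonneg.2 (hx _)) hdx.le)

lemma Gw_nonpos_of_isMax {d : ℕ} {dx : ℝ} (hdx : 0 < dx) (μ : Measure (Ed d))
    {α β : Fin d → ℤ}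
    (h : ∀ x ∈ cell d dx α, ∀ y, ind d (cell d dx β) y ≤ ind d (cell d dx β) x) :
    Gw d dx μ α β ≤ 0 := by
  have hc : 0 ≤ (dx ^ d)⁻¹ := by positivity
  refine add_nonpos (mul_nonpos_of_nonneg_of_nonpos hc ?_)
    (mul_nonpos_of_nonneg_of_nonpos hc (Finset.sum_nonpos fun l _ => ?_))
  · exact setIntegral_nonpos (measurableSet_cell d dx α) fun x hx =>
      integral_nonpos fun z => sub_nonpos.2 (h x hx _)
  · rw [← integral_const_mul]
    exact setIntegral_nonpos (measurableSet_cell d dx α) fun x hx =>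
      gam_mul_Dup_nonpos hdx μ l (h x hx)

lemma Gw_nonneg_of_isMin {d : ℕ} {dx : ℝ} (hdx : 0 < dx) (μ : Measure (Ed d))
    {α β : Fin d → ℤ}
    (h : ∀ x ∈ cell d dx α, ∀ y, ind d (cell d dx β) x ≤ ind d (cell d dx β) y) :
    0 ≤ Gw d dx μ α β := by
  have hc : 0 ≤ (dx ^ d)⁻¹ := by positivity
  refine add_nonneg (mul_nonneg hc ?_) (mul_nonneg hc (Finset.sum_nonneg fun l _ => ?_))
  · exact setIntegral_nonneg (measurableSet_cell d dx α) fun x hx =>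
      integral_nonneg fun z => sub_nonneg.2 (h x hx _)
  · rw [← integral_const_mul]
    exact setIntegral_nonneg (measurableSet_cell d dx α) fun x hx =>
      gam_mul_Dup_nonneg hdx μ l (h x hx)

theorem stmt2 (d : ℕ) (hd : 1 ≤ d) (dx : ℝ) (hdx0 : 0 < dx) (hdx1 : dx < 1)
    (μ : Measure (Ed d)) (hμ0 : μ {0} = 0)
    (hμfin : ∫⁻ z, ENNReal.ofReal (min (‖z‖ ^ 2) 1) ∂μ < ⊤) :
    (∀ β : Fin d → ℤ, Gw d dx μ β β ≤ 0) ∧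
    (∀ α β : Fin d → ℤ, α ≠ β → 0 ≤ Gw d dx μ α β) := by
  refine ⟨fun β => Gw_nonpos_of_isMax hdx0 μ fun x hx y => ?_,
    fun α β hαβ => Gw_nonneg_of_isMin hdx0 μ fun x hx y => ?_⟩
  · have h1 : ind d (cell d dx β) x = 1 := indicator_of_mem hx _
    exact h1 ▸ ind_le_one d _ y
  · have h0 : ind d (cell d dx β) x = 0 :=
      indicator_of_notMem (fun hx' => hαβ (cell_index_unique hdx0 hx hx')) _
    exact h0 ▸ ind_nonneg d _ y
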